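/- Let r be a positive integer, a, b > 0 real numbers, and u : ℝ² → ℝ a function that is 2r−2 times continuously differentiable. Then there exists a real polynomial φ₃ in two variables, belonging to the linear span of the monomials (x/a)^j (y/b)^l with (j,l) ∈ Ω₃, such that the function φ₀₁₂ = u − φ₃ satisfies, for all nonnegative integers k₁, k₂ with k₁ + k₂ ≤ 2r − 2: φ₀₁₂^{(k₁,k₂)}(a,b) − φ₀₁₂^{(k₁,k₂)}(a,−b) − φ₀₁₂^{(k₁,k₂)}(−a,b) + φ₀₁₂^{(k₁,k₂)}(−a,−b) = 0. -/

import Mathlib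

/-- `Ω₃₁ = {(2j+2, 2l+2) : j,l ≥ 0, j+l ≤ r−2}`. -/
def Omega31 (r : ℕ) : Set (ℕ × ℕ) :=
  {p | ∃ j l, j + l + 2 ≤ r ∧ p = (2 * j + 2, 2 * l + 2)}

/-- `Ω₃₂ = {(2j+1, 2l+2) : j,l ≥ 0, j+l ≤ r−2}`. -/
def Omega32 (r : ℕ) : Set (ℕ × ℕ) :=
  {p | ∃ j l, j + l + 2 ≤ r ∧ p = (2 * j + 1, 2 * l + 2)}

/-- `Ω₃₃ = {(2j+2, 2l+1) : j,l ≥ 0, j+l ≤ r−2}`. -/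
def Omega33 (r : ℕ) : Set (ℕ × ℕ) :=
  {p | ∃ j l, j + l + 2 ≤ r ∧ p = (2 * j + 2, 2 * l + 1)}

/-- `Ω₃₄ = {(2j+1, 2l+1) : j,l ≥ 0, j+l ≤ r−1}`. -/
def Omega34 (r : ℕ) : Set (ℕ × ℕ) :=
  {p | ∃ j l, j + l + 1 ≤ r ∧ p = (2 * j + 1, 2 * l + 1)}

/-- `Ω₃ = Ω₃₁ ∪ Ω₃₂ ∪ Ω₃₃ ∪ Ω₃₄`. -/
def Omega3 (r : ℕ) : Set (ℕ × ℕ) := Omega31 r ∪ Omega32 r ∪ Omega33 r ∪ Omega34 r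

/-- The mixed partial derivative `∂ₓ^{k₁} ∂_y^{k₂} f (x, y)` of a two-variable function. -/
noncomputable def partialDeriv2 (f : ℝ → ℝ → ℝ) (k₁ k₂ : ℕ) (x y : ℝ) : ℝ :=
  iteratedDeriv k₁ (fun s => iteratedDeriv k₂ (fun t => f s t) y) x

/-- The corner double-difference
`∂^{(k₁,k₂)}f(a,b) − ∂^{(k₁,k₂)}f(a,−b) − ∂^{(k₁,k₂)}f(−a,b) + ∂^{(k₁,k₂)}f(−a,−b)`. -/
noncomputable def cornerDiff (f : ℝ → ℝ → ℝ) (k₁ k₂ : ℕ) (a b : ℝ) : ℝ :=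
  partialDeriv2 f k₁ k₂ a b - partialDeriv2 f k₁ k₂ a (-b) -
    partialDeriv2 f k₁ k₂ (-a) b + partialDeriv2 f k₁ k₂ (-a) (-b)

/-- The jump of the `k`-th derivative of `(x / a) ^ j` between `-a` and `a`. -/
noncomputable def monomialJump (a : ℝ) (k j : ℕ) : ℝ :=
  iteratedDeriv k (fun x : ℝ => (x / a) ^ j) a - iteratedDeriv k (fun x : ℝ => (x / a) ^ j) (-a)

theorem iteratedDeriv_div_pow (a : ℝ) (k j : ℕ) (x : ℝ) :
    iteratedDeriv k (fun x : ℝ => (x / a) ^ j) x =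
      (j.descFactorial k : ℝ) * x ^ (j - k) / a ^ j := by
  have h : (fun x : ℝ => (x / a) ^ j) = fun x => (a ^ j)⁻¹ * x ^ j := by
    funext x
    rw [div_pow, div_eq_inv_mul]
  rw [h, iteratedDeriv_const_mul_field, iteratedDeriv_pow]
  ring

theorem monomialJump_eq_zero {a : ℝ} {k j : ℕ} (h : j ≤ k) : monomialJump a k j = 0 := by
  simp [monomialJump, iteratedDeriv_div_pow, Nat.sub_eq_zero_of_le h]

theorem monomialJump_succ_ne_zero {a : ℝ} (ha : a ≠ 0) (k : ℕ) :
    monomialJump a k (k + 1) ≠ 0 := by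
  have h : ((k + 1).descFactorial k : ℝ) ≠ 0 := by
    exact_mod_cast (Nat.descFactorial_pos.mpr k.le_succ).ne'
  have : monomialJump a k (k + 1) = 2 * ((k + 1).descFactorial k : ℝ) * a / a ^ (k + 1) := by
    simp only [monomialJump, iteratedDeriv_div_pow, Nat.add_sub_cancel_left, pow_one]
    ring
  rw [this]
  positivity

/-- A strictly triangular array `D` with nonvanishing
leading entries can be inverted by coefficient vectors supported in `[1, m + 1]`. -/
theorem exists_dual_coeff (D : ℕ → ℕ → ℝ) (h0 : ∀ k j, j ≤ k → D k j = 0)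
    (h1 : ∀ k, D k (k + 1) ≠ 0) (N m : ℕ) (hm : m + 1 < N) :
    ∃ e : ℕ → ℝ, (∀ j, e j ≠ 0 → 1 ≤ j ∧ j ≤ m + 1) ∧
      ∀ k, ∑ j ∈ Finset.range N, e j * D k j = if k = m then 1 else 0 := by
  induction m using Nat.strong_induction_on with
  | _ m ih =>
    have ih' : ∀ i, ∃ e : ℕ → ℝ, i < m → (∀ j, e j ≠ 0 → 1 ≤ j ∧ j ≤ i + 1) ∧
        ∀ k, ∑ j ∈ Finset.range N, e j * D k j = if k = i then 1 else 0 := by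
      intro i
      by_cases hi : i < m
      · obtain ⟨e, he⟩ := ih i hi (by omega)
        exact ⟨e, fun _ => he⟩
      · exact ⟨0, fun h => absurd h hi⟩
    choose E hE using ih'
    refine ⟨fun j => (D m (m + 1))⁻¹ * ((if j = m + 1 then 1 else 0) -
      ∑ i ∈ Finset.range m, D i (m + 1) * E i j), ?_, ?_⟩
    · intro j hj
      by_contra hc
      apply hj
      have hs : ∑ i ∈ Finset.range m, D i (m + 1) * E i j = 0 := by
        refine Finset.sum_eq_zero fun i hi => ?_
        have hi := Finset.mem_range.mp hi
        have : E i j = 0 := by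
          by_contra hne
          have := (hE i hi).1 j hne
          omega
        rw [this, mul_zero]
      have hne : j ≠ m + 1 := by omega
      simp [hs, hne]
    · intro k
      have hs : ∑ j ∈ Finset.range N, (∑ i ∈ Finset.range m, D i (m + 1) * E i j) * D k j =
          if k < m then D k (m + 1) else 0 := by
        simp_rw [Finset.sum_mul, mul_assoc]
        rw [Finset.sum_comm]
        simp_rw [← Finset.mul_sum]
        rw [Finset.sum_congr rfl fun i hi => by rw [(hE i (Finset.mem_range.mp hi)).2 k]]
        simp
      have hd : ∑ j ∈ Finset.range N, (if j = m + 1 then (1 : ℝ) else 0) * D k j =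
          D k (m + 1) := by
        simp [hm]
      simp_rw [mul_assoc, ← Finset.mul_sum, sub_mul, Finset.sum_sub_distrib]
      rw [hs, hd]
      rcases lt_trichotomy k m with h | h | h
      · simp [h, h.ne]
      · subst h
        simp [h1 k]
      · simp [h0 k (m + 1) h, h.ne', h.not_gt]

theorem contDiff_iteratedDeriv_snd (n k : ℕ) (u : ℝ × ℝ → ℝ)
    (hu : ContDiff ℝ (n + k : ℕ) u) :
    ContDiff ℝ n (fun p : ℝ × ℝ => iteratedDeriv k (fun t => u (p.1, t)) p.2) := by
  induction k generalizing u with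
  | zero => simpa using hu
  | succ k ih =>
    have hd : Differentiable ℝ u := hu.differentiable (by norm_cast)
    have h : ∀ s : ℝ, deriv (fun t => u (s, t)) = fun t => fderiv ℝ u (s, t) (0, 1) := by
      intro s
      funext t
      have hg : HasDerivAt (fun t : ℝ => (s, t)) (0, 1) t :=
        (hasDerivAt_const t s).prodMk (hasDerivAt_id t)
      exact ((hd (s, t)).hasFDerivAt.comp_hasDerivAt t hg).deriv
    simp_rw [iteratedDeriv_succ', h]
    refine ih (fun p => fderiv ℝ u p (0, 1)) ?_
    exact (hu.fderiv_right (m := (n + k : ℕ)) (by norm_cast)).clm_apply contDiff_const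

theorem partialDeriv2_sub_sum (u : ℝ × ℝ → ℝ) (k₁ k₂ : ℕ) (hu : ContDiff ℝ (k₁ + k₂ : ℕ) u)
    (s : Finset (ℕ × ℕ)) (c : ℕ × ℕ → ℝ) (a b x y : ℝ) :
    partialDeriv2 (fun x y => u (x, y) - ∑ p ∈ s, c p * (x / a) ^ p.1 * (y / b) ^ p.2) k₁ k₂ x y =
      partialDeriv2 (fun x y => u (x, y)) k₁ k₂ x y -
        ∑ p ∈ s, c p * iteratedDeriv k₁ (fun x : ℝ => (x / a) ^ p.1) x *
          iteratedDeriv k₂ (fun y : ℝ => (y / b) ^ p.2) y := by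
  have hin : ∀ z : ℝ, iteratedDeriv k₂
      (fun t => u (z, t) - ∑ p ∈ s, c p * (z / a) ^ p.1 * (t / b) ^ p.2) y =
      iteratedDeriv k₂ (fun t => u (z, t)) y -
        ∑ p ∈ s, c p * iteratedDeriv k₂ (fun y : ℝ => (y / b) ^ p.2) y * (z / a) ^ p.1 := by
    intro z
    have hz : ContDiff ℝ k₂ (fun t => u (z, t)) :=
      (hu.of_le (by norm_cast; omega)).comp (contDiff_const.prodMk contDiff_id)
    rw [iteratedDeriv_fun_sub hz.contDiffAt (by fun_prop),
      iteratedDeriv_fun_sum (by intros; fun_prop)]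
    congr 1
    refine Finset.sum_congr rfl fun p _ => ?_
    rw [iteratedDeriv_const_mul_field]
    ring
  have hout : ContDiff ℝ k₁ (fun z => iteratedDeriv k₂ (fun t => u (z, t)) y) :=
    (contDiff_iteratedDeriv_snd k₁ k₂ u hu).comp (contDiff_id.prodMk contDiff_const)
  unfold partialDeriv2
  simp_rw [hin]
  rw [iteratedDeriv_fun_sub hout.contDiffAt (by fun_prop),
    iteratedDeriv_fun_sum (by intros; fun_prop)]
  congr 1
  refine Finset.sum_congr rfl fun p _ => ?_
  rw [iteratedDeriv_const_mul_field]
  ring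

theorem cornerDiff_sub_sum (u : ℝ × ℝ → ℝ) (k₁ k₂ : ℕ) (hu : ContDiff ℝ (k₁ + k₂ : ℕ) u)
    (s : Finset (ℕ × ℕ)) (c : ℕ × ℕ → ℝ) (a b : ℝ) :
    cornerDiff (fun x y => u (x, y) - ∑ p ∈ s, c p * (x / a) ^ p.1 * (y / b) ^ p.2) k₁ k₂ a b =
      cornerDiff (fun x y => u (x, y)) k₁ k₂ a b -
        ∑ p ∈ s, c p * monomialJump a k₁ p.1 * monomialJump b k₂ p.2 := by
  have h : ∑ p ∈ s, c p * monomialJump a k₁ p.1 * monomialJump b k₂ p.2 =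
      ∑ p ∈ s, c p * iteratedDeriv k₁ (fun x : ℝ => (x / a) ^ p.1) a *
          iteratedDeriv k₂ (fun y : ℝ => (y / b) ^ p.2) b -
      ∑ p ∈ s, c p * iteratedDeriv k₁ (fun x : ℝ => (x / a) ^ p.1) a *
          iteratedDeriv k₂ (fun y : ℝ => (y / b) ^ p.2) (-b) -
      ∑ p ∈ s, c p * iteratedDeriv k₁ (fun x : ℝ => (x / a) ^ p.1) (-a) *
          iteratedDeriv k₂ (fun y : ℝ => (y / b) ^ p.2) b +
      ∑ p ∈ s, c p * iteratedDeriv k₁ (fun x : ℝ => (x / a) ^ p.1) (-a) *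
          iteratedDeriv k₂ (fun y : ℝ => (y / b) ^ p.2) (-b) := by
    simp_rw [← Finset.sum_sub_distrib, ← Finset.sum_add_distrib]
    refine Finset.sum_congr rfl fun p _ => ?_
    unfold monomialJump
    ring
  rw [h]
  simp only [cornerDiff, partialDeriv2_sub_sum u k₁ k₂ hu]
  ring

theorem mem_Omega3 {r p q : ℕ} (hp : 1 ≤ p) (hq : 1 ≤ q) (h : p + q ≤ 2 * r) :
    (p, q) ∈ Omega3 r := by
  rcases Nat.even_or_odd' p with ⟨j, rfl | rfl⟩ <;> rcases Nat.even_or_odd' q with ⟨l, rfl | rfl⟩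
  · exact Or.inl (Or.inl (Or.inl ⟨j - 1, l - 1, by omega,
      Prod.ext (by dsimp only; omega) (by dsimp only; omega)⟩))
  · exact Or.inl (Or.inr ⟨j - 1, l, by omega, Prod.ext (by dsimp only; omega) rfl⟩)
  · exact Or.inl (Or.inl (Or.inr ⟨j, l - 1, by omega, Prod.ext rfl (by dsimp only; omega)⟩))
  · exact Or.inr ⟨j, l, by omega, rfl⟩

/-- Corner-function step of the structural decomposition of a two-dimensional function
over `[−a,a] × [−b,b]` (Section 2.2, situation 1, Eqs. (3)–(4)): if `u` is `2r − 2` times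
continuously differentiable, there is a polynomial corner function
`φ₃(x,y) = ∑_{(j,l) ∈ Ω₃} c_{j,l} (x/a)^j (y/b)^l` such that `φ₀₁₂ = u − φ₃` has vanishing
corner double-differences for all partial derivatives of total order at most `2r − 2`. -/
theorem corner_decomposition (r : ℕ) (hr : 0 < r) (a b : ℝ) (ha : 0 < a) (hb : 0 < b)
    (u : ℝ × ℝ → ℝ) (hu : ContDiff ℝ (2 * r - 2 : ℕ) u) :
    ∃ c : ℕ × ℕ → ℝ,
      (∀ p : ℕ × ℕ, p ∉ Omega3 r → c p = 0) ∧
      ∀ k₁ k₂ : ℕ, k₁ + k₂ ≤ 2 * r - 2 →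
        cornerDiff
          (fun x y => u (x, y) -
            ∑ p ∈ Finset.range (2 * r + 1) ×ˢ Finset.range (2 * r + 1),
              c p * (x / a) ^ p.1 * (y / b) ^ p.2) k₁ k₂ a b = 0 := by
  have hdual : ∀ a : ℝ, 0 < a → ∀ m, ∃ e : ℕ → ℝ, m + 1 < 2 * r + 1 →
      (∀ j, e j ≠ 0 → 1 ≤ j ∧ j ≤ m + 1) ∧
      ∀ k, ∑ j ∈ Finset.range (2 * r + 1), e j * monomialJump a k j = if k = m then 1 else 0 := by
    intro a ha m
    by_cases hm : m + 1 < 2 * r + 1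
    · obtain ⟨e, he⟩ := exists_dual_coeff (monomialJump a) (fun _ _ => monomialJump_eq_zero)
        (monomialJump_succ_ne_zero ha.ne') (2 * r + 1) m hm
      exact ⟨e, fun _ => he⟩
    · exact ⟨0, fun h => absurd h hm⟩
  choose e he using hdual a ha
  choose f hf using hdual b hb
  set S := (Finset.range (2 * r - 1) ×ˢ Finset.range (2 * r - 1)).filter
    (fun m => m.1 + m.2 ≤ 2 * r - 2) with hS
  have hmem : ∀ m, m ∈ S ↔ m.1 + m.2 ≤ 2 * r - 2 := by
    intro m
    simp only [hS, Finset.mem_filter, Finset.mem_product, Finset.mem_range]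
    omega
  set d : ℕ × ℕ → ℝ := fun m => cornerDiff (fun x y => u (x, y)) m.1 m.2 a b
  refine ⟨fun p => ∑ m ∈ S, d m * (e m.1 p.1 * f m.2 p.2), ?_, ?_⟩
  · rintro ⟨p, q⟩ hpq
    refine Finset.sum_eq_zero fun m hm => ?_
    have hm := (hmem m).1 hm
    by_contra hne
    have h1 := (he m.1 (by omega)).1 p fun h => hne (by simp [h])
    have h2 := (hf m.2 (by omega)).1 q fun h => hne (by simp [h])
    exact hpq (mem_Omega3 h1.1 h2.1 (by omega))
  · intro k₁ k₂ hk
    rw [cornerDiff_sub_sum u k₁ k₂ (hu.of_le (by exact_mod_cast hk)), sub_eq_zero]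
    have hm : ∀ m ∈ S, ∑ p ∈ Finset.range (2 * r + 1) ×ˢ Finset.range (2 * r + 1),
        d m * (e m.1 p.1 * f m.2 p.2) * monomialJump a k₁ p.1 * monomialJump b k₂ p.2 =
        if m = (k₁, k₂) then d m else 0 := by
      intro m hm
      have hm := (hmem m).1 hm
      calc _ = d m * ((∑ i ∈ Finset.range (2 * r + 1), e m.1 i * monomialJump a k₁ i) *
            ∑ j ∈ Finset.range (2 * r + 1), f m.2 j * monomialJump b k₂ j) := by
            rw [Finset.sum_mul_sum, ← Finset.sum_product', Finset.mul_sum]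
            refine Finset.sum_congr rfl fun p _ => ?_
            ring
        _ = _ := by
            rw [(he m.1 (by omega)).2, (hf m.2 (by omega)).2]
            by_cases h1 : k₁ = m.1 <;> by_cases h2 : k₂ = m.2 <;>
              simp [h1, h2, Prod.ext_iff, eq_comm]
    simp_rw [Finset.sum_mul]
    rw [Finset.sum_comm, Finset.sum_congr rfl hm, Finset.sum_ite_eq', if_pos ((hmem _).2 hk)]
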